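/- Fix an integer g ≥ 2. For each m ≥ 1 let B_m ⊆ ℤΣ_m be the subgroup generated by the permutations σ ∈ Σ_m with S_2(σ) ≥ m − 1 − g. Then ∂ maps B_{m+1} into B_m, and for every m with 2 ≤ m ≤ g+1 the resulting sequence B_{m+1} → B_m → B_{m−1} is exact at B_m: every element of B_m killed by ∂ lies in ∂(B_{m+1}). (This is the combinatorial form, via the permutation map P, of Harer's split-exactness of C_{p+1}(F;2)/Γ(F) → C_p(F;2)/Γ(F) → C_{p−1}(F;2)/Γ(F) for 1 ≤ p ≤ g, where F is a surface of genus g with boundary.) -/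

import Mathlib

open Equiv

/-- The `j`-th face of a permutation of `Fin (n+1)`: delete the entry `σ j` from the
one-line notation and decrease by one every remaining entry exceeding `σ j`. -/
def permFace {n : ℕ} (σ : Equiv.Perm (Fin (n + 1))) (j : Fin (n + 1)) :
    Equiv.Perm (Fin n) :=
  (finSuccAboveEquiv j).trans
    ((σ.subtypeEquiv (fun a => (σ.injective.ne_iff (x := a) (y := j)).symm)).trans
      (finSuccAboveEquiv (σ j)).symm)

/-- The hat `σ̂ ∈ Σ_{n+1}` of `σ ∈ Σ_n`: `σ̂ 0 = 0` and `σ̂ (j+1) = σ j + 1`. -/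
def permHat {n : ℕ} (σ : Equiv.Perm (Fin n)) : Equiv.Perm (Fin (n + 1)) :=
  (finSuccEquiv n).symm.permCongr σ.optionCongr

/-- The alternating-sum boundary map `∂ : ℤΣ_{n+1} → ℤΣ_n`. -/
def permBdry (n : ℕ) :
    FreeAbelianGroup (Equiv.Perm (Fin (n + 1))) →+ FreeAbelianGroup (Equiv.Perm (Fin n)) :=
  FreeAbelianGroup.lift fun σ =>
    ∑ j : Fin (n + 1), (-1 : ℤ) ^ (j : ℕ) • FreeAbelianGroup.of (permFace σ j)

/-- The linear extension `D : ℤΣ_n → ℤΣ_{n+1}` of the hat operation. -/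
def permHatMap (n : ℕ) :
    FreeAbelianGroup (Equiv.Perm (Fin n)) →+ FreeAbelianGroup (Equiv.Perm (Fin (n + 1))) :=
  FreeAbelianGroup.lift fun σ => FreeAbelianGroup.of (permHat σ)

/-- The number of orbits (cycles, counting fixed points) of a permutation of `Fin m`. -/
def permCyc {m : ℕ} (π : Equiv.Perm (Fin m)) : ℕ :=
  π.cycleType.card + (Finset.univ.filter fun x => π x = x).card

/-- The genus `S_2(σ) = (m − Cyc(c_m σ⁻¹ c_m⁻¹ σ))/2` of `σ ∈ Σ_m`. -/
def permS2 {m : ℕ} (σ : Equiv.Perm (Fin m)) : ℕ :=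
  (m - permCyc (finRotate m * σ⁻¹ * (finRotate m)⁻¹ * σ)) / 2

/-- The genus `S_1(σ) = ((m+1) − Cyc(c_{m+1} σ̂⁻¹ c_{m+1}⁻¹ σ̂))/2` of `σ ∈ Σ_m`. -/
def permS1 {m : ℕ} (σ : Equiv.Perm (Fin m)) : ℕ :=
  ((m + 1) -
    permCyc (finRotate (m + 1) * (permHat σ)⁻¹ * (finRotate (m + 1))⁻¹ * permHat σ)) / 2

/-- The subgroup `B_m ⊆ ℤΣ_m` generated by the permutations `σ` with `S_2 σ ≥ m − 1 − g`. -/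
def genusSubgroup2 (g m : ℕ) : AddSubgroup (FreeAbelianGroup (Equiv.Perm (Fin m))) :=
  AddSubgroup.closure
    (FreeAbelianGroup.of '' {σ : Equiv.Perm (Fin m) | (m : ℤ) - 1 - g ≤ (permS2 σ : ℤ)})

/-- The number of cycles of a permutation is the number of classes of `Perm.SameCycle`. -/
theorem permCyc_eq_card_quotient {m : ℕ} (f : Perm (Fin m)) :
    permCyc f = Nat.card (Quotient (Perm.SameCycle.setoid f)) := by
  classical
  let F : Fin m → Perm (Fin m) ⊕ Fin m := fun x => if f x = x then .inr x else .inl (f.cycleOf x)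
  have hker : Setoid.ker F = Perm.SameCycle.setoid f := by
    ext x y
    change F x = F y ↔ f.SameCycle x y
    by_cases hx : f x = x <;> by_cases hy : f y = y
    · simp only [F, hx, hy, if_true, Sum.inr.injEq]
      exact ⟨fun h => h ▸ Perm.SameCycle.refl f x,
        fun h => (Perm.SameCycle.eq_of_left h hx)⟩
    · simp only [F, hx, hy, if_true, if_false, reduceCtorEq, false_iff]
      exact fun h => hy (h.apply_eq_self_iff.1 hx)
    · simp only [F, hx, hy, if_true, if_false, reduceCtorEq, false_iff]
      exact fun h => hx (h.apply_eq_self_iff.2 hy)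
    · simp only [F, hx, hy, if_false, Sum.inl.injEq]
      exact (Perm.sameCycle_iff_cycleOf_eq_of_mem_support (Perm.mem_support.2 hx)
        (Perm.mem_support.2 hy)).symm
  have hrange : Set.range F =
      ↑(f.cycleFactorsFinset.disjSum (Finset.univ.filter fun x => f x = x)) := by
    ext z
    simp only [Set.mem_range, Finset.mem_coe, Finset.mem_disjSum, Finset.mem_filter,
      Finset.mem_univ, true_and]
    constructor
    · rintro ⟨x, rfl⟩
      by_cases hx : f x = x
      · exact .inr ⟨x, hx, by simp [F, hx]⟩
      · refine .inl ⟨f.cycleOf x, ?_, by simp [F, hx]⟩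
        exact Perm.cycleOf_mem_cycleFactorsFinset_iff.2 (Perm.mem_support.2 hx)
    · rintro (⟨c, hc, rfl⟩ | ⟨x, hx, rfl⟩)
      · obtain ⟨x, hx⟩ := (Perm.mem_cycleFactorsFinset_iff.1 hc).1.nonempty_support
        have hx' := Perm.mem_support.1 (Perm.mem_cycleFactorsFinset_support_le hc hx)
        exact ⟨x, by simp [F, hx', Perm.cycle_is_cycleOf hx hc]⟩
      · exact ⟨x, by simp [F, hx]⟩
  rw [← hker, Nat.card_congr (Setoid.quotientKerEquivRange F), hrange, Nat.card_coe_set_eq,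
    Set.ncard_coe_finset, Finset.card_disjSum, permCyc, Perm.cycleType_def]
  simp

/-- A transposition on the left destroys at most one cycle. -/
theorem permCyc_le_permCyc_swap_mul_add_one {m : ℕ} (a b : Fin m) (f : Perm (Fin m)) :
    permCyc f ≤ permCyc (swap a b * f) + 1 := by
  classical
  rw [permCyc_eq_card_quotient, permCyc_eq_card_quotient]
  set g := swap a b * f with hg
  let R : Fin m → Fin m → Prop := fun x y => f.SameCycle x y ∨
    ((f.SameCycle x a ∨ f.SameCycle x b) ∧ (f.SameCycle y a ∨ f.SameCycle y b))
  have hR : Equivalence R := by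
    refine ⟨fun x => .inl (.refl f x), fun {x y} h => ?_, fun {x y z} h h' => ?_⟩
    · exact h.imp (fun h => h.symm) And.symm
    · rcases h with h | ⟨hx, hy⟩ <;> rcases h' with h' | ⟨hy', hz⟩
      · exact .inl (h.trans h')
      · exact .inr ⟨hy'.imp h.trans h.trans, hz⟩
      · exact .inr ⟨hx, hy.imp h'.symm.trans h'.symm.trans⟩
      · exact .inr ⟨hx, hz⟩
  have hstep (x : Fin m) : R x (g x) := by
    have hx : f.SameCycle x (f x) := ⟨1, by simp⟩
    rw [hg, Perm.mul_apply]
    by_cases ha : f x = a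
    · rw [ha, swap_apply_left]
      exact .inr ⟨.inl (ha ▸ hx), .inr (.refl _ _)⟩
    by_cases hb : f x = b
    · rw [hb, swap_apply_right]
      exact .inr ⟨.inr (hb ▸ hx), .inl (.refl _ _)⟩
    rw [swap_apply_of_ne_of_ne ha hb]
    exact .inl hx
  have hpow (n : ℕ) (x : Fin m) : R x ((g ^ n) x) := by
    induction n with
    | zero => exact hR.refl x
    | succ n ih => rw [pow_succ', Perm.mul_apply]; exact hR.trans ih (hstep _)
  have hsame {x y : Fin m} (h : g.SameCycle x y) : R x y := by
    obtain ⟨n, -, -, rfl⟩ := h.exists_pow_eq'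
    exact hpow n x
  let s := Perm.SameCycle.setoid f
  let t := Perm.SameCycle.setoid g
  let G : Quotient s → Option (Quotient t) := fun q =>
    if q = Quotient.mk s a then none else some (Quotient.mk t q.out)
  have hG : Function.Injective G := by
    intro p q hpq
    by_cases hp : p = Quotient.mk s a <;> by_cases hq : q = Quotient.mk s a
    · rw [hp, hq]
    · simp [G, hp, hq] at hpq
    · simp [G, hp, hq] at hpq
    · simp only [G, hp, hq, if_false, Option.some.injEq] at hpq
      have ne {p : Quotient s} (hp : p ≠ Quotient.mk s a) : ¬ f.SameCycle p.out a :=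
        fun h => hp (by rw [← Quotient.out_eq p]; exact Quotient.sound h)
      have key : f.SameCycle p.out q.out := by
        rcases hsame (Quotient.exact hpq) with h | ⟨h, h'⟩
        · exact h
        · exact (h.resolve_left (ne hp)).trans (h'.resolve_left (ne hq)).symm
      rw [← Quotient.out_eq p, ← Quotient.out_eq q]
      exact Quotient.sound key
  simpa using Nat.card_le_card_of_injective G hG

theorem permCyc_add_sum_cycleType {m : ℕ} (f : Perm (Fin m)) :
    permCyc f + f.cycleType.sum = m + f.cycleType.card := by
  have h := Finset.card_filter_add_card_filter_not (s := (Finset.univ : Finset (Fin m)))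
    (fun x => f x = x)
  have h' : f.support = Finset.univ.filter fun x => ¬ f x = x := by ext; simp
  rw [Finset.card_univ, Fintype.card_fin, ← h', ← Perm.sum_cycleType] at h
  rw [permCyc]
  omega

theorem permCyc_inv {m : ℕ} (f : Perm (Fin m)) : permCyc f⁻¹ = permCyc f := by
  have h₁ := permCyc_add_sum_cycleType f
  have h₂ := permCyc_add_sum_cycleType f⁻¹
  rw [Perm.cycleType_inv] at h₂
  omega

/-- Multiplying by a transposition on either side creates at most one cycle each. -/
theorem permCyc_swap_mul_mul_swap_le {m : ℕ} (a b c d : Fin m) (f : Perm (Fin m)) :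
    permCyc (swap a b * f * swap c d) ≤ permCyc f + 2 := by
  have h₁ := permCyc_le_permCyc_swap_mul_add_one a b (swap a b * f * swap c d)
  have h₂ := permCyc_le_permCyc_swap_mul_add_one c d (f * swap c d)⁻¹
  rw [permCyc_inv] at h₂
  simp only [mul_assoc, swap_mul_self_mul] at h₁
  rw [mul_inv_rev, swap_inv, swap_mul_self_mul, permCyc_inv] at h₂
  rw [mul_assoc]
  omega

theorem permCyc_extendDomain {m n : ℕ} {p : Fin n → Prop} [DecidablePred p]
    (e : Fin m ≃ Subtype p) (f : Perm (Fin m)) :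
    permCyc (f.extendDomain e) + m = permCyc f + n := by
  have h₁ := permCyc_add_sum_cycleType f
  have h₂ := permCyc_add_sum_cycleType (f.extendDomain e)
  rw [Perm.cycleType_extendDomain] at h₂
  omega

/-- The permutations of genus zero are rotations. -/
theorem permS2_pos {m : ℕ} {σ : Perm (Fin m)} (h : ¬ Commute σ (finRotate m)) :
    1 ≤ permS2 σ := by
  set f := finRotate m * σ⁻¹ * (finRotate m)⁻¹ * σ with hf
  have hne : f ≠ 1 := by
    intro h1
    refine h ?_
    rw [hf, mul_eq_one_iff_eq_inv, mul_inv_eq_iff_eq_mul, mul_inv_eq_iff_eq_mul, mul_assoc,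
      eq_inv_mul_iff_mul_eq] at h1
    exact h1
  have hsign : Perm.sign f = 1 := by
    simp only [hf, map_mul, map_inv]
    rw [mul_right_comm, inv_mul_cancel_right, mul_inv_cancel]
  have hcard : 0 < f.cycleType.card :=
    Nat.pos_of_ne_zero fun h0 => hne (Perm.card_cycleType_eq_zero.1 h0)
  have hsum : f.cycleType.card * 2 ≤ f.cycleType.sum := by
    simpa using Multiset.card_nsmul_le_sum (s := f.cycleType) (a := 2)
      fun x hx => Perm.two_le_of_mem_cycleType hx
  have heven : Even (f.cycleType.sum + f.cycleType.card) := by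
    rw [Perm.sign_of_cycleType] at hsign
    by_contra hodd
    rw [Nat.not_even_iff_odd] at hodd
    rw [hodd.neg_one_pow] at hsign
    exact absurd hsign (by decide)
  have hc := permCyc_add_sum_cycleType f
  obtain ⟨r, hr⟩ := heven
  rw [permS2, ← hf]
  omega

@[simp]
theorem succAbove_permFace {n : ℕ} (σ : Perm (Fin (n + 1))) (j : Fin (n + 1)) (i : Fin n) :
    (σ j).succAbove (permFace σ j i) = σ (j.succAbove i) :=
  congrArg Subtype.val ((finSuccAboveEquiv (σ j)).apply_symm_apply
    ⟨σ (j.succAbove i), σ.injective.ne (j.succAbove_ne i)⟩)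

theorem swap_finRotate_succAbove {n : ℕ} (j : Fin (n + 1)) (i : Fin n) :
    (swap j (finRotate (n + 1) j) * finRotate (n + 1)) (j.succAbove i) =
      j.succAbove (finRotate n i) := by
  obtain ⟨n, rfl⟩ : ∃ k, n = k + 1 := ⟨n - 1, by have := i.isLt; omega⟩
  rw [Perm.mul_apply, swap_apply_def]
  have h1 := coe_finRotate (j.succAbove i)
  have h2 := coe_finRotate i
  have h3 := coe_finRotate j
  rw [if_neg ((finRotate (n + 2)).injective.ne (j.succAbove_ne i))]
  have hi := i.isLt
  have hj := j.isLt
  ext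
  simp only [Fin.ext_iff, Fin.val_last, Fin.succAbove, Fin.lt_def, Fin.val_castSucc,
    Nat.succ_eq_add_one] at h1 h2 h3 ⊢
  split_ifs at h1 h2 h3 ⊢ <;> simp_all <;> omega

/-- Deleting the point `j` from the cyclic rotation gives the cyclic rotation. -/
theorem swap_mul_finRotate_eq_extendDomain {n : ℕ} (j : Fin (n + 1)) :
    swap j (finRotate (n + 1) j) * finRotate (n + 1) =
      (finRotate n).extendDomain (finSuccAboveEquiv j) := by
  ext1 x
  obtain rfl | ⟨i, rfl⟩ := j.eq_self_or_eq_succAbove x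
  · rw [Perm.extendDomain_apply_not_subtype _ _ (by simp), Perm.mul_apply, swap_apply_right]
  · rw [swap_finRotate_succAbove]
    exact (Perm.extendDomain_apply_image (finRotate n) (finSuccAboveEquiv j) i).symm

theorem permS2_le_permS2_permFace_add_one {n : ℕ} (σ : Perm (Fin (n + 1))) (j : Fin (n + 1)) :
    permS2 σ ≤ permS2 (permFace σ j) + 1 := by
  set c := finRotate (n + 1) with hc
  set τ := permFace σ j with hτ
  have key : (finRotate n * τ⁻¹ * (finRotate n)⁻¹ * τ).extendDomain (finSuccAboveEquiv j) =
      swap j (c j) * (c * σ⁻¹ * c⁻¹ * σ) * swap j (σ⁻¹ (c (σ j))) := by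
    have hswap : swap (σ j) (c (σ j)) * σ = σ * swap j (σ⁻¹ (c (σ j))) := by
      rw [mul_swap_eq_swap_mul]; simp
    have : swap j (c j) * (c * σ⁻¹ * c⁻¹ * σ) * swap j (σ⁻¹ (c (σ j))) =
        (swap j (c j) * c) * σ⁻¹ * (swap (σ j) (c (σ j)) * c)⁻¹ * σ := by
      simp only [mul_inv_rev, swap_inv, mul_assoc, hswap]
    rw [this, hc, swap_mul_finRotate_eq_extendDomain, swap_mul_finRotate_eq_extendDomain]
    ext1 x
    obtain rfl | ⟨i, rfl⟩ := j.eq_self_or_eq_succAbove x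
    · simp only [Perm.mul_apply, Perm.extendDomain_inv]
      rw [Perm.extendDomain_apply_not_subtype _ _ (by simp),
        Perm.extendDomain_apply_not_subtype _ _ (b := σ _) (by simp), Perm.inv_def,
        Equiv.symm_apply_apply,
        Perm.extendDomain_apply_not_subtype _ _ (by simp)]
    · have ext_apply (p : Fin (n + 1)) (f : Perm (Fin n)) (i : Fin n) :
          f.extendDomain (finSuccAboveEquiv p) (p.succAbove i) = p.succAbove (f i) :=
        Perm.extendDomain_apply_image f (finSuccAboveEquiv p) i
      have hinv (i : Fin n) : σ⁻¹ ((σ j).succAbove i) = j.succAbove (τ⁻¹ i) := by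
        rw [Perm.inv_eq_iff_eq, ← succAbove_permFace, ← hτ, Perm.inv_def, Equiv.apply_symm_apply]
      rw [ext_apply]
      simp only [Perm.mul_apply, Perm.extendDomain_inv]
      rw [← succAbove_permFace, ext_apply, hinv, ext_apply]
  have h₁ := permCyc_swap_mul_mul_swap_le j (c j) j (σ⁻¹ (c (σ j))) (c * σ⁻¹ * c⁻¹ * σ)
  have h₂ := permCyc_extendDomain (finSuccAboveEquiv j)
    (finRotate n * τ⁻¹ * (finRotate n)⁻¹ * τ)
  rw [key] at h₂
  rw [permS2, permS2, ← hc]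
  omega

theorem permFace_eq {n : ℕ} {σ : Perm (Fin (n + 1))} {j : Fin (n + 1)} {τ : Perm (Fin n)}
    (h : ∀ i, (σ j).succAbove (τ i) = σ (j.succAbove i)) : permFace σ j = τ :=
  Equiv.ext fun i => (σ j).succAbove_right_injective <| by rw [succAbove_permFace, h]

theorem permFace_permFace_succAbove {n : ℕ} (σ : Perm (Fin (n + 2))) (j : Fin (n + 2))
    (i : Fin (n + 1)) :
    permFace (permFace σ (j.succAbove i)) (i.predAbove j) = permFace (permFace σ j) i := by
  have hv : permFace σ (j.succAbove i) (i.predAbove j) = (permFace σ j i).predAbove (σ j) := by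
    apply (σ (j.succAbove i)).succAbove_right_injective
    rw [succAbove_permFace, Fin.succAbove_succAbove_predAbove, ← succAbove_permFace,
      Fin.succAbove_succAbove_predAbove]
  refine permFace_eq fun k => (σ (j.succAbove i)).succAbove_right_injective ?_
  rw [hv, succAbove_permFace, Fin.succAbove_succAbove_succAbove_predAbove, ← succAbove_permFace,
    Fin.succAbove_succAbove_succAbove_predAbove, succAbove_permFace, succAbove_permFace]

theorem permBdry_of {n : ℕ} (σ : Perm (Fin (n + 1))) :
    permBdry n (.of σ) =
      ∑ j : Fin (n + 1), (-1 : ℤ) ^ (j : ℕ) • FreeAbelianGroup.of (permFace σ j) :=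
  FreeAbelianGroup.lift_apply_of _ _

theorem permHatMap_of {n : ℕ} (σ : Perm (Fin n)) :
    permHatMap n (.of σ) = FreeAbelianGroup.of (permHat σ) :=
  FreeAbelianGroup.lift_apply_of _ _

theorem permBdry_permBdry {n : ℕ} (x : FreeAbelianGroup (Perm (Fin (n + 2)))) :
    permBdry n (permBdry (n + 1) x) = 0 := by
  suffices h : (permBdry n).comp (permBdry (n + 1)) = 0 from DFunLike.congr_fun h x
  ext σ
  simp only [AddMonoidHom.comp_apply, AddMonoidHom.zero_apply, permBdry_of, map_sum, map_zsmul,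
    Finset.smul_sum, smul_smul, ← pow_add]
  rw [← Fintype.sum_prod_type' (f := fun (j : Fin (n + 2)) (i : Fin (n + 1)) =>
    (-1 : ℤ) ^ (j + i : ℕ) • FreeAbelianGroup.of (permFace (permFace σ j) i))]
  refine Finset.sum_involution (fun p _ => (p.1.succAbove p.2, p.2.predAbove p.1)) ?_ ?_
    (fun _ _ => Finset.mem_univ _) ?_
  · rintro ⟨j, i⟩ -
    rw [permFace_permFace_succAbove, Fin.neg_one_pow_succAbove_add_predAbove, neg_smul,
      add_neg_cancel]
  · rintro ⟨j, i⟩ - - h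
    exact j.succAbove_ne i (congrArg Prod.fst h)
  · rintro ⟨j, i⟩ -
    have h := Fin.succAbove_succAbove_predAbove j i
    refine Prod.ext h (j.succAbove_right_injective ?_)
    conv_lhs => rw [← h]
    simp only [h]
    conv_rhs => rw [← Fin.succAbove_succAbove_predAbove (j.succAbove i) (i.predAbove j), h]

@[simp]
theorem permHat_zero {n : ℕ} (σ : Perm (Fin n)) : permHat σ 0 = 0 := by
  simp [permHat]

@[simp]
theorem permHat_succ {n : ℕ} (σ : Perm (Fin n)) (i : Fin n) :
    permHat σ i.succ = (σ i).succ := by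
  simp [permHat]

theorem permFace_permHat_zero {n : ℕ} (σ : Perm (Fin n)) : permFace (permHat σ) 0 = σ :=
  permFace_eq fun i => by simp

theorem permFace_permHat_succ {n : ℕ} (σ : Perm (Fin (n + 1))) (j : Fin (n + 1)) :
    permFace (permHat σ) j.succ = permHat (permFace σ j) :=
  permFace_eq fun i => by cases i using Fin.cases <;> simp

/-- The hat operation is a contracting homotopy. -/
theorem permBdry_permHatMap {n : ℕ} (x : FreeAbelianGroup (Perm (Fin (n + 1)))) :
    permBdry (n + 1) (permHatMap (n + 1) x) = x - permHatMap n (permBdry n x) := by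
  suffices h : (permBdry (n + 1)).comp (permHatMap (n + 1)) =
      AddMonoidHom.id _ - (permHatMap n).comp (permBdry n) from DFunLike.congr_fun h x
  ext σ
  simp only [AddMonoidHom.comp_apply, AddMonoidHom.sub_apply, AddMonoidHom.id_apply, permBdry_of,
    permHatMap_of, map_sum, map_zsmul]
  rw [Fin.sum_univ_succ]
  simp [permFace_permHat_zero, permFace_permHat_succ, pow_succ, sub_eq_add_neg]

theorem eq_one_of_commute_permHat {n : ℕ} {σ : Perm (Fin n)}
    (h : Commute (permHat σ) (finRotate (n + 1))) : σ = 1 := by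
  have hfix (i : Fin (n + 1)) : permHat σ i = i := by
    induction i using Fin.induction with
    | zero => simp
    | succ i ih =>
      have hi : i.succ = finRotate (n + 1) i.castSucc := by simp
      rw [hi, ← Perm.mul_apply, h.eq, Perm.mul_apply, ih]
  ext1 i
  exact Fin.succ_injective _ (by rw [← permHat_succ, hfix, Perm.one_apply])

theorem permFace_cycleRange_self {n : ℕ} (i : Fin (n + 1)) : permFace i.cycleRange i = 1 :=
  permFace_eq fun k => by simp

theorem permFace_cycleRange_ne_one {n : ℕ} {i j : Fin (n + 1)} (hi : 2 ≤ (i : ℕ)) (hj : j ≠ i) :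
    permFace i.cycleRange j ≠ 1 := by
  intro h
  have hmono : StrictMono (i.cycleRange ∘ j.succAbove) := by
    convert (i.cycleRange j).strictMono_succAbove using 1
    funext k
    rw [Function.comp_apply, ← succAbove_permFace, h, Perm.one_apply]
  obtain ⟨p, hp, hpj⟩ : ∃ p : Fin (n + 1), p < i ∧ p ≠ j := by
    by_cases h0 : (j : ℕ) = 0
    · exact ⟨⟨1, by omega⟩, Fin.lt_def.2 hi, fun e => by simp [← e] at h0⟩
    · exact ⟨⟨0, by omega⟩, Fin.lt_def.2 (by grind), fun e => by simp [← e] at h0⟩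
  obtain ⟨p, rfl⟩ := Fin.exists_succAbove_eq hpj
  obtain ⟨q, rfl⟩ := Fin.exists_succAbove_eq hj.symm
  have := hmono (j.strictMono_succAbove.lt_iff_lt.1 hp)
  simp at this

theorem not_commute_cycleRange_finRotate {n : ℕ} {i : Fin (n + 1)} (hi : 2 ≤ (i : ℕ))
    (hin : i ≠ Fin.last n) : ¬ Commute i.cycleRange (finRotate (n + 1)) := by
  intro h
  obtain ⟨k, rfl⟩ : ∃ k : Fin n, i = k.succ := ⟨i.pred (by rintro rfl; simp at hi), by simp⟩
  have hk : k.succ = finRotate (n + 1) k.castSucc := by simp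
  have h1 : Fin.cycleRange k.succ k.succ =
      finRotate (n + 1) (Fin.cycleRange k.succ k.castSucc) := by
    conv_lhs => enter [2]; rw [hk]
    rw [← Perm.mul_apply, h.eq, Perm.mul_apply]
  rw [Fin.cycleRange_self, Fin.cycleRange_of_lt k.castSucc_lt_succ, Fin.coeSucc_eq_succ] at h1
  have h2 := coe_finRotate_of_ne_last hin
  rw [← h1] at h2
  simp at h2

theorem of_mem_genusSubgroup2 {g m : ℕ} {σ : Perm (Fin m)} (h : (m : ℤ) - 1 - g ≤ permS2 σ) :
    FreeAbelianGroup.of σ ∈ genusSubgroup2 g m :=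
  AddSubgroup.subset_closure ⟨σ, h, rfl⟩

theorem FreeAbelianGroup.map_mem_of_forall_of_mem {α G : Type*} [AddCommGroup G]
    (f : FreeAbelianGroup α →+ G) (B : AddSubgroup G) (h : ∀ a, f (.of a) ∈ B)
    (x : FreeAbelianGroup α) : f x ∈ B := by
  induction x using FreeAbelianGroup.induction_on with
  | zero => rw [map_zero]; exact B.zero_mem
  | of a => exact h a
  | neg a ih => rw [map_neg]; exact B.neg_mem ih
  | add x y hx hy => rw [map_add]; exact B.add_mem hx hy

theorem of_mem_genusSubgroup2_of_not_commute {l : ℕ} {σ : Perm (Fin (l + 4))}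
    (h : ¬ Commute σ (finRotate (l + 4))) :
    FreeAbelianGroup.of σ ∈ genusSubgroup2 (l + 2) (l + 4) :=
  of_mem_genusSubgroup2 (by have := permS2_pos h; push_cast; omega)

theorem permBdry_mem_genusSubgroup2 {g m : ℕ} {x : FreeAbelianGroup (Perm (Fin (m + 1)))}
    (hx : x ∈ genusSubgroup2 g (m + 1)) : permBdry m x ∈ genusSubgroup2 g m := by
  suffices h : genusSubgroup2 g (m + 1) ≤ (genusSubgroup2 g m).comap (permBdry m) from h hx
  refine (AddSubgroup.closure_le _).2 ?_
  rintro _ ⟨σ, hσ, rfl⟩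
  rw [SetLike.mem_coe, AddSubgroup.mem_comap, permBdry_of]
  refine AddSubgroup.sum_mem _ fun j _ => AddSubgroup.zsmul_mem _ (of_mem_genusSubgroup2 ?_) _
  have h := permS2_le_permS2_permFace_add_one σ j
  rw [Set.mem_ofPred_eq] at hσ
  push_cast at hσ
  omega

/-- The hat operation corrected by a boundary so as to avoid the identity permutation. -/
def permHatMapAdjusted (l : ℕ) :
    FreeAbelianGroup (Perm (Fin (l + 3))) →+ FreeAbelianGroup (Perm (Fin (l + 4))) :=
  FreeAbelianGroup.lift fun σ => FreeAbelianGroup.of (permHat σ) -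
    if σ = 1 then permBdry (l + 4) (permHatMap (l + 4) (-.of (Fin.cycleRange (2 : Fin (l + 4)))))
    else 0

theorem permBdry_permHatMapAdjusted {l : ℕ} (x : FreeAbelianGroup (Perm (Fin (l + 3)))) :
    permBdry (l + 3) (permHatMapAdjusted l x) = permBdry (l + 3) (permHatMap (l + 3) x) := by
  suffices h : (permBdry (l + 3)).comp (permHatMapAdjusted l) =
      (permBdry (l + 3)).comp (permHatMap (l + 3)) from DFunLike.congr_fun h x
  ext σ
  rw [AddMonoidHom.comp_apply, AddMonoidHom.comp_apply, permHatMap_of, permHatMapAdjusted,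
    FreeAbelianGroup.lift_apply_of, map_sub]
  split_ifs
  · rw [permBdry_permBdry, sub_zero]
  · rw [map_zero, sub_zero]

theorem permHatMapAdjusted_mem {l : ℕ} (x : FreeAbelianGroup (Perm (Fin (l + 3)))) :
    permHatMapAdjusted l x ∈ genusSubgroup2 (l + 2) (l + 4) := by
  refine FreeAbelianGroup.map_mem_of_forall_of_mem _ _ (fun σ => ?_) x
  rw [permHatMapAdjusted, FreeAbelianGroup.lift_apply_of]
  split_ifs with hσ
  · subst hσ
    have h2 : ((2 : Fin (l + 4)) : ℕ) = 2 := rfl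
    have hlast : (2 : Fin (l + 4)) ≠ Fin.last (l + 3) := by
      rw [ne_eq, Fin.ext_iff, h2, Fin.val_last]
      omega
    set ω := Fin.cycleRange (2 : Fin (l + 4)) with hω
    rw [permBdry_permHatMap, map_neg, map_neg, permBdry_of, map_sum,
      ← Finset.add_sum_erase _ _ (Finset.mem_univ (2 : Fin (l + 4))), permFace_cycleRange_self, h2,
      map_zsmul, permHatMap_of]
    have hmem : .of ω - ∑ j ∈ Finset.univ.erase (2 : Fin (l + 4)),
        permHatMap (l + 3) ((-1 : ℤ) ^ (j : ℕ) • FreeAbelianGroup.of (permFace ω j)) ∈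
        genusSubgroup2 (l + 2) (l + 4) := by
      refine AddSubgroup.sub_mem _ (of_mem_genusSubgroup2_of_not_commute
        (not_commute_cycleRange_finRotate h2.ge hlast)) (AddSubgroup.sum_mem _ fun j hj => ?_)
      rw [map_zsmul, permHatMap_of]
      exact AddSubgroup.zsmul_mem _ (of_mem_genusSubgroup2_of_not_commute fun h =>
        permFace_cycleRange_ne_one h2.ge (Finset.ne_of_mem_erase hj)
          (eq_one_of_commute_permHat h)) _
    convert hmem using 1
    rw [neg_one_sq, one_smul]
    abel
  · rw [sub_zero]
    exact of_mem_genusSubgroup2_of_not_commute fun h => hσ (eq_one_of_commute_permHat h)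

/-- Fix `g ≥ 2`. Then `∂` maps `B_{m+1}` into `B_m` (for `m ≥ 1`), and for
every `2 ≤ m ≤ g + 1` (here `m = k + 2`) the sequence `B_{m+1} → B_m → B_{m−1}` is exact
at `B_m`: every element of `B_m` killed by `∂` lies in `∂ (B_{m+1})`. -/
theorem genus2_subcomplex_exact (g : ℕ) (hg : 2 ≤ g) :
    (∀ m : ℕ, 1 ≤ m → ∀ x ∈ genusSubgroup2 g (m + 1), permBdry m x ∈ genusSubgroup2 g m) ∧
    (∀ k : ℕ, k + 2 ≤ g + 1 → ∀ x ∈ genusSubgroup2 g (k + 2),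
      permBdry (k + 1) x = 0 → ∃ y ∈ genusSubgroup2 g (k + 3), permBdry (k + 2) y = x) := by
  refine ⟨fun m _ x hx => permBdry_mem_genusSubgroup2 hx, fun k hk x _ hx0 => ?_⟩
  have hx : permBdry (k + 2) (permHatMap (k + 2) x) = x := by
    rw [permBdry_permHatMap, hx0, map_zero, sub_zero]
  by_cases hkg : k + 2 ≤ g
  · refine ⟨_, FreeAbelianGroup.map_mem_of_forall_of_mem _ _ (fun σ => ?_) x, hx⟩
    rw [permHatMap_of]
    exact of_mem_genusSubgroup2 (by push_cast; omega)
  · obtain ⟨l, rfl⟩ : ∃ l, k = l + 1 := ⟨k - 1, by omega⟩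
    obtain rfl : g = l + 2 := by omega
    exact ⟨_, permHatMapAdjusted_mem x, (permBdry_permHatMapAdjusted x).trans hx⟩
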